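/- arXiv:1811.08089 — 3 statements merged into one kernel-verified Lean document; each statement's English description precedes it below -/
import Mathlib

section
/- Let (S^A, S^B) be a pair of finite orthonormal families of vectors in a finite-dimensional complex inner product space H. If (S^A, S^B) is perfectly distinguishable by post-processing and every pair of one state in S^A and one state in S^B is non-orthogonal (i.e., ⟨φ^A_a, φ^B_b⟩ ≠ 0 for all a ∈ K_A, b ∈ K_B), then dim H ≥ |S^A| + |S^B| − 1. -/
open scoped Classical

notation "⟪" x ", " y "⟫_ℂ" => @inner ℂ _ _ x y

noncomputable section

/-- A POVM over a finite index type `Ω`: a family of positive semidefinite operators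
on `H` summing to the identity. -/
def IsPOVM {H : Type*} [NormedAddCommGroup H] [InnerProductSpace ℂ H]
    {Ω : Type*} [Fintype Ω] (M : Ω → H →ₗ[ℂ] H) : Prop :=
  (∀ ω x, 0 ≤ (⟪x, M ω x⟫_ℂ).re ∧ (⟪x, M ω x⟫_ℂ).im = 0) ∧
    ∑ ω, M ω = LinearMap.id

/-- `(φA, φB)` is perfectly distinguishable by post-processing. -/
def PerfectlyDistinguishable {H : Type*} [NormedAddCommGroup H] [InnerProductSpace ℂ H]
    {KA KB : Type*} [Fintype KA] [Fintype KB] (φA : KA → H) (φB : KB → H) : Prop :=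
  ∃ (N : ℕ) (M : Fin N → H →ₗ[ℂ] H) (fA : Fin N → KA) (fB : Fin N → KB),
    IsPOVM M ∧
    (∀ a, ∑ ω ∈ Finset.univ.filter (fun ω => fA ω = a), ⟪φA a, M ω (φA a)⟫_ℂ = 1) ∧
    (∀ b, ∑ ω ∈ Finset.univ.filter (fun ω => fB ω = b), ⟪φB b, M ω (φB b)⟫_ℂ = 1)

/-- A standard pair in `ℂ^{K_A × K_B}`. -/
def IsStandardPair {KA KB : Type*} [Fintype KA] [Fintype KB]
    (ΦA : KA → EuclideanSpace ℂ (KA × KB)) (ΦB : KB → EuclideanSpace ℂ (KA × KB)) : Prop :=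
  ∃ (α β : KA → KB → ℂ),
    (∀ a, ∑ b, ‖α a b‖ ^ 2 = 1) ∧ (∀ b, ∑ a, ‖β a b‖ ^ 2 = 1) ∧
    (∀ a, ΦA a = ∑ b, α a b • EuclideanSpace.single (a, b) (1 : ℂ)) ∧
    (∀ b, ΦB b = ∑ a, β a b • EuclideanSpace.single (a, b) (1 : ℂ))

/-- Right stochastic matrix: nonnegative entries, rows sum to 1. -/
def RightStochastic {n m : Type*} [Fintype m] (A : Matrix n m ℝ) : Prop :=
  (∀ i j, 0 ≤ A i j) ∧ ∀ i, ∑ j, A i j = 1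

/-- Left stochastic matrix: nonnegative entries, columns sum to 1. -/
def LeftStochastic {n m : Type*} [Fintype n] (B : Matrix n m ℝ) : Prop :=
  (∀ i j, 0 ≤ B i j) ∧ ∀ j, ∑ i, B i j = 1

/-- Membership in `D̄(n,m)`: decomposable into an entrywise product of a right
stochastic matrix and a left stochastic matrix. -/
def MemDBar {n m : Type*} [Fintype n] [Fintype m] (P : Matrix n m ℝ) : Prop :=
  ∃ A B : Matrix n m ℝ, RightStochastic A ∧ LeftStochastic B ∧ ∀ i j, P i j = A i j * B i j

/-- Membership in `D(n,m)`: members of `D̄(n,m)` with all entries strictly positive. -/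
def MemD {n m : Type*} [Fintype n] [Fintype m] (P : Matrix n m ℝ) : Prop :=
  MemDBar P ∧ ∀ i j, 0 < P i j

/-- A measurement table for `(φA, φB)`. -/
def IsMeasurementTable {H : Type*} [NormedAddCommGroup H] [InnerProductSpace ℂ H]
    {KA KB : Type*} [Fintype KA] [Fintype KB]
    (φA : KA → H) (φB : KB → H) (M : KA × KB → H →ₗ[ℂ] H) : Prop :=
  IsPOVM M ∧
    (∀ a, ∑ b, ⟪φA a, M (a, b) (φA a)⟫_ℂ = 1) ∧
    (∀ b, ∑ a, ⟪φB b, M (a, b) (φB b)⟫_ℂ = 1)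

/-- A positive operator kills every vector at which its quadratic form vanishes. -/
theorem LinearMap.IsPositive.apply_eq_zero_of_inner_eq_zero {H : Type*}
    [NormedAddCommGroup H] [InnerProductSpace ℂ H] {T : H →ₗ[ℂ] H} (hT : T.IsPositive)
    {x : H} (hx : ⟪x, T x⟫_ℂ = 0) : T x = 0 := by
  have key : ∀ t : ℝ, 0 ≤ -2 * t * ‖T x‖ ^ 2 + t ^ 2 * (⟪T x, T (T x)⟫_ℂ).re := by
    intro t
    have h := hT.re_inner_nonneg_right (x - (t : ℂ) • T x)
    have hsymm : ⟪x, T (T x)⟫_ℂ = ⟪T x, T x⟫_ℂ := (hT.isSymmetric x (T x)).symm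
    have hself : ⟪T x, T x⟫_ℂ = ((‖T x‖ ^ 2 : ℝ) : ℂ) := by
      rw [inner_self_eq_norm_sq_to_K]; push_cast; rfl
    have hexp : ⟪x - (t : ℂ) • T x, T (x - (t : ℂ) • T x)⟫_ℂ =
        ((-2 * t * ‖T x‖ ^ 2 : ℝ) : ℂ) + ((t ^ 2 : ℝ) : ℂ) * ⟪T x, T (T x)⟫_ℂ := by
      simp only [map_sub, map_smul, inner_sub_left, inner_sub_right, inner_smul_left,
        inner_smul_right, hx, hsymm, hself, Complex.conj_ofReal]
      push_cast
      ring
    rw [hexp] at h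
    simpa [← Complex.ofReal_pow, Complex.re_ofReal_mul] using h
  have hc : 0 ≤ (⟪T x, T (T x)⟫_ℂ).re := hT.re_inner_nonneg_right (T x)
  set c := (⟪T x, T (T x)⟫_ℂ).re
  have h := key (‖T x‖ ^ 2 / (c + 1))
  have hsq : (‖T x‖ ^ 2 / (c + 1)) * (c + 1) = ‖T x‖ ^ 2 := by field_simp
  set s := ‖T x‖ ^ 2 / (c + 1)
  have hs : s = 0 := by
    rw [← hsq] at h
    nlinarith [sq_nonneg s, mul_nonneg (sq_nonneg s) hc]
  rw [hs, zero_mul] at hsq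
  simpa using hsq.symm

/-- The elements of a POVM are positive operators. -/
theorem IsPOVM.isPositive {H : Type*} [NormedAddCommGroup H] [InnerProductSpace ℂ H]
    {Ω : Type*} [Fintype Ω] {M : Ω → H →ₗ[ℂ] H} (hM : IsPOVM M) (ω : Ω) :
    (M ω).IsPositive := by
  rw [LinearMap.isPositive_iff_complex]
  intro x
  obtain ⟨h0, h1⟩ := hM.1 ω x
  rw [← inner_conj_symm, Complex.conj_re] at h0
  rw [← inner_conj_symm, Complex.conj_im, neg_eq_zero] at h1
  exact ⟨Complex.ext rfl h1.symm, h0⟩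

open scoped ComplexOrder in
/-- If a unit vector is detected with certainty by the outcomes in `s`, every POVM element
outside `s` annihilates it. -/
theorem IsPOVM.apply_eq_zero {H : Type*} [NormedAddCommGroup H] [InnerProductSpace ℂ H]
    {Ω : Type*} [Fintype Ω] {M : Ω → H →ₗ[ℂ] H} (hM : IsPOVM M) {x : H} (hx : ‖x‖ = 1)
    {s : Finset Ω} (hs : ∑ ω ∈ s, ⟪x, M ω x⟫_ℂ = 1) {ω : Ω} (hω : ω ∉ s) : M ω x = 0 := by
  have htot : ∑ ω, ⟪x, M ω x⟫_ℂ = 1 := by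
    rw [← inner_sum, ← LinearMap.sum_apply, hM.2, LinearMap.id_apply,
      inner_self_eq_norm_sq_to_K, hx]
    simp
  have hcompl : ∑ ω ∈ sᶜ, ⟪x, M ω x⟫_ℂ = 0 := by
    rw [← Finset.sum_add_sum_compl s, hs] at htot
    simpa using htot
  have hzero := (Finset.sum_eq_zero_iff_of_nonneg
    fun i _ ↦ (hM.isPositive i).inner_nonneg_right x).1 hcompl
  exact (hM.isPositive ω).apply_eq_zero_of_inner_eq_zero
    (hzero ω (Finset.mem_compl.2 hω))

/-- If `M` reads off the index of each vector of `u` through `f` and of `v` through `g`, then in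
a relation `∑ i, c i • u i = ∑ j, d j • v j` the vanishing of `c i` forces that of `d j` whenever
`u i` and `v j` are not orthogonal. -/
theorem IsPOVM.coeff_eq_zero {H : Type*} [NormedAddCommGroup H] [InnerProductSpace ℂ H]
    {Ω ι κ : Type*} [Fintype Ω] [Fintype ι] [Fintype κ] {M : Ω → H →ₗ[ℂ] H} (hM : IsPOVM M)
    {u : ι → H} {v : κ → H} {f : Ω → ι} {g : Ω → κ}
    (hu : ∀ ω i, f ω ≠ i → M ω (u i) = 0) (hv : ∀ ω j, g ω ≠ j → M ω (v j) = 0)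
    {c : ι → ℂ} {d : κ → ℂ} (h : ∑ i, c i • u i = ∑ j, d j • v j)
    {i : ι} (hi : c i = 0) {j : κ} (hij : ⟪u i, v j⟫_ℂ ≠ 0) : d j = 0 := by
  have hterm : ∀ ω, d j * ⟪u i, M ω (v j)⟫_ℂ = 0 := by
    intro ω
    by_cases hf : f ω = i
    · by_cases hg : g ω = j
      · have h' := congrArg (M ω) h
        simp only [map_sum, map_smul] at h'
        rw [Finset.sum_eq_single (f ω) (fun k _ hk ↦ by rw [hu ω k hk.symm, smul_zero])
            (by simp),
          Finset.sum_eq_single (g ω) (fun k _ hk ↦ by rw [hv ω k hk.symm, smul_zero])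
            (by simp), hf, hg, hi, zero_smul] at h'
        rw [← inner_smul_right, ← h', inner_zero_right]
      · rw [hv ω j hg, inner_zero_right, mul_zero]
    · rw [← (hM.isPositive ω).isSymmetric, hu ω i hf, inner_zero_left, mul_zero]
  have hprod : d j * ⟪u i, v j⟫_ℂ = 0 := by
    have hvj : v j = ∑ ω, M ω (v j) := by
      rw [← LinearMap.sum_apply, hM.2, LinearMap.id_apply]
    rw [hvj, inner_sum, Finset.mul_sum]
    exact Finset.sum_eq_zero fun ω _ ↦ hterm ω
  exact (mul_eq_zero.1 hprod).resolve_right hij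

/-- Proposition 2: if the pair is perfectly distinguishable and every cross pair of
states is non-orthogonal, then `dim H ≥ |S^A| + |S^B| - 1`. -/
theorem dim_lower_bound_of_distinguishable
    {H : Type*} [NormedAddCommGroup H] [InnerProductSpace ℂ H] [FiniteDimensional ℂ H]
    {KA KB : Type*} [Fintype KA] [Fintype KB]
    (φA : KA → H) (φB : KB → H) (hA : Orthonormal ℂ φA) (hB : Orthonormal ℂ φB)
    (hd : PerfectlyDistinguishable φA φB)
    (hno : ∀ a b, ⟪φA a, φB b⟫_ℂ ≠ 0) :
    Fintype.card KA + Fintype.card KB - 1 ≤ Module.finrank ℂ H := by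
  obtain ⟨N, M, fA, fB, hM, hfA, hfB⟩ := hd
  have hMA : ∀ ω a, fA ω ≠ a → M ω (φA a) = 0 := fun ω a h ↦
    hM.apply_eq_zero (hA.1 a) (hfA a) (by simpa using h)
  have hMB : ∀ ω b, fB ω ≠ b → M ω (φB b) = 0 := fun ω b h ↦
    hM.apply_eq_zero (hB.1 b) (hfB b) (by simpa using h)
  rcases isEmpty_or_nonempty KA with _ | ⟨⟨a₀⟩⟩
  · have := hB.linearIndependent.fintype_card_le_finrank
    simp only [Fintype.card_eq_zero]
    lia
  rcases isEmpty_or_nonempty KB with _ | ⟨⟨b₀⟩⟩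
  · have := hA.linearIndependent.fintype_card_le_finrank
    simp only [Fintype.card_eq_zero]
    lia
  let L : (KA → ℂ) × (KB → ℂ) →ₗ[ℂ] H × ℂ :=
    ((Fintype.linearCombination ℂ φA).coprod (-Fintype.linearCombination ℂ φB)).prod
      ((LinearMap.proj a₀).comp (LinearMap.fst ℂ _ _))
  have hL : Function.Injective L := by
    rw [← LinearMap.ker_eq_bot, LinearMap.ker_eq_bot']
    rintro ⟨x, y⟩ hxy
    obtain ⟨h, hx₀⟩ : (∑ a, x a • φA a) + -(∑ b, y b • φB b) = 0 ∧ x a₀ = 0 := by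
      simpa [L, Fintype.linearCombination_apply] using hxy
    rw [← sub_eq_add_neg, sub_eq_zero] at h
    have hy : ∀ b, y b = 0 := fun b ↦ hM.coeff_eq_zero hMA hMB h hx₀ (hno a₀ b)
    have hx : ∀ a, x a = 0 := fun a ↦
      hM.coeff_eq_zero hMB hMA h.symm (hy b₀) (mt inner_eq_zero_symm.1 (hno a b₀))
    exact Prod.ext (funext hx) (funext hy)
  have := LinearMap.finrank_le_finrank_of_injective hL
  simp only [Module.finrank_prod, Module.finrank_fintype_fun_eq_card, Module.finrank_self] at this
  lia

end
end

section
/- Let n ≥ 2 and m ≥ 2. For any n×m real matrix P ∈ D̄(n,m) and any n×m real matrix Q with 0 ≤ Q_{ij} ≤ P_{ij} for all entries (i,j), it holds that Q ∈ D̄(n,m). -/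
open scoped Classical

noncomputable section

lemma sum_eq_sum_of_eq_off_pair {ι : Type*} [Fintype ι] {f g : ι → ℝ} {x y : ι} (hxy : x ≠ y)
    (hpair : f x + f y = g x + g y) (hoff : ∀ z, z ≠ x → z ≠ y → f z = g z) :
    ∑ z, f z = ∑ z, g z := by
  rw [← sub_eq_zero, ← Finset.sum_sub_distrib, Fintype.sum_eq_add x y hxy]
  · linarith
  · rintro z ⟨hx, hy⟩
    rw [hoff z hx hy, sub_self]

/-- Weight can be shifted within the rows of a positive `2 × 2` table so that the sum of the
quotients `p / a + r / c` in the first column attains a prescribed larger value, while the sum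
`q / b + u / d` in the second column does not change. -/
lemma exists_rebalance {a b c d p q r u τ : ℝ} (ha : 0 < a) (hb : 0 < b) (hc : 0 < c)
    (hd : 0 < d) (hp : 0 < p) (hq : 0 < q) (hr : 0 < r) (hu : 0 < u)
    (hτ : p / a + r / c ≤ τ) :
    ∃ a' b' c' d' : ℝ, 0 < a' ∧ 0 < b' ∧ 0 < c' ∧ 0 < d' ∧ a' + b' = a + b ∧
      c' + d' = c + d ∧ p / a' + r / c' = τ ∧ q / b' + u / d' = q / b + u / d := by
  have hpa : 0 < p / a := by positivity
  have hrc : 0 < r / c := by positivity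
  have hud : 0 < u / d := by positivity
  have hτ0 : 0 < τ := by linarith
  have hlow : 0 < p / τ := by positivity
  have hlow_le : p / τ ≤ a := by
    rw [div_le_iff₀ hτ0, ← div_le_iff₀' ha]
    linarith
  let v : ℝ → ℝ := fun x => q / b + u / d - q / (a + b - x)
  have hv : ∀ x ≤ a, u / d ≤ v x := fun x hx => by
    have : q / (a + b - x) ≤ q / b := div_le_div_of_nonneg_left hq.le hb (by linarith)
    simp only [v]
    linarith
  have hv0 : ∀ x ≤ a, 0 < v x := fun x hx => hud.trans_le (hv x hx)
  have hy : ∀ x ≤ a, u / v x ≤ d := fun x hx => by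
    rw [div_le_iff₀ (hv0 x hx), ← div_le_iff₀' hd]
    exact hv x hx
  have hcont : ContinuousOn (fun x => p / x + r / (c + d - u / v x)) (Set.Icc (p / τ) a) := by
    have hvc : ContinuousOn v (Set.Icc (p / τ) a) := by
      refine continuousOn_const.sub (continuousOn_const.div (by fun_prop) fun x hx => ?_)
      have := hx.2
      linarith
    refine (continuousOn_const.div continuousOn_id fun x hx => ?_).add
      (continuousOn_const.div (continuousOn_const.sub (continuousOn_const.div hvc fun x hx => ?_))
        fun x hx => ?_)
    · exact (hlow.trans_le hx.1).ne'
    · exact (hv0 x hx.2).ne'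
    · have := hy x hx.2
      linarith
  have hva : v a = u / d := by simp [v]
  obtain ⟨x, hx, hfx⟩ := intermediate_value_Icc' hlow_le hcont (show τ ∈ Set.Icc _ _ by
    constructor
    · simpa [hva, hu.ne', hd.ne'] using hτ
    · have h1 := hy _ hlow_le
      have h2 : 0 ≤ r / (c + d - u / v (p / τ)) := div_nonneg hr.le (by linarith)
      have h3 : p / (p / τ) = τ := by field_simp
      simp only [h3]
      linarith)
  have h1 := hy x hx.2
  have h2 := hv0 x hx.2
  refine ⟨x, a + b - x, c + d - u / v x, u / v x, hlow.trans_le hx.1, ?_, ?_, by positivity,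
    by ring, by ring, hfx, ?_⟩
  · linarith [hx.2]
  · linarith
  · rw [div_div_cancel₀ hu.ne']
    simp only [v]
    ring

section

variable {ι κ : Type*} [Fintype κ]

lemma RightStochastic.mix_uniform [Nonempty κ] {A : Matrix ι κ ℝ} (hA : RightStochastic A)
    {ε : ℝ} (hε : 0 < ε) (hε1 : ε < 1) :
    RightStochastic (fun i j => (1 - ε) * A i j + ε / Fintype.card κ : Matrix ι κ ℝ) := by
  refine ⟨fun i j => ?_, fun i => ?_⟩
  · have := mul_nonneg (sub_pos.2 hε1).le (hA.1 i j)
    positivity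
  · rw [Finset.sum_add_distrib, ← Finset.mul_sum, hA.2 i]
    simp [mul_div_cancel₀]

lemma isCompact_setOf_rightStochastic :
    IsCompact {A : Matrix ι κ ℝ | RightStochastic A} := by
  have hK : IsCompact (Set.pi Set.univ fun _ : ι => Set.pi Set.univ fun _ : κ =>
      Set.Icc (0 : ℝ) 1) :=
    isCompact_univ_pi fun _ => isCompact_univ_pi fun _ => isCompact_Icc
  refine hK.of_isClosed_subset ?_ fun A hA i _ j _ => ⟨hA.1 i j, ?_⟩
  · simp only [RightStochastic, Set.ofPred_and, Set.ofPred_forall]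
    refine (isClosed_iInter fun i => isClosed_iInter fun j => ?_).inter
      (isClosed_iInter fun i => ?_)
    · exact isClosed_le continuous_const (continuous_id.matrix_elem i j)
    · exact isClosed_eq (continuous_finsetSum _ fun j _ => continuous_id.matrix_elem i j)
        continuous_const
  · rw [← hA.2 i]
    exact Finset.single_le_sum (fun k _ => hA.1 i k) (Finset.mem_univ j)

variable [Fintype ι]

lemma RightStochastic.exists_sum_div_column_eq_one [Nontrivial ι] [Nontrivial κ]
    {A Q : Matrix ι κ ℝ} (hQ : ∀ i j, 0 < Q i j) (hA : RightStochastic A)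
    (hA0 : ∀ i j, 0 < A i j) {j : κ} (hj : ∑ i, Q i j / A i j ≤ 1) :
    ∃ A' : Matrix ι κ ℝ, RightStochastic A' ∧ (∀ i j, 0 < A' i j) ∧
      ∑ i, Q i j / A' i j = 1 ∧
      ∀ l, l ≠ j → ∑ i, Q i l / A' i l = ∑ i, Q i l / A i l := by
  obtain ⟨i, i', hi⟩ := exists_pair_ne ι
  obtain ⟨j', hj'⟩ := exists_ne j
  obtain ⟨a, b, c, d, ha, hb, hc, hd, hab, hcd, hcol, hcol'⟩ :=
    exists_rebalance (hA0 i j) (hA0 i j') (hA0 i' j) (hA0 i' j') (hQ i j) (hQ i j') (hQ i' j)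
      (hQ i' j') (τ := Q i j / A i j + Q i' j / A i' j + (1 - ∑ k, Q k j / A k j)) (by linarith)
  let A' : Matrix ι κ ℝ := fun k l =>
    if k = i then if l = j then a else if l = j' then b else A k l
    else if k = i' then if l = j then c else if l = j' then d else A k l
    else A k l
  have h₁ : A' i j = a := by simp [A']
  have h₂ : A' i j' = b := by simp [A', hj']
  have h₃ : A' i' j = c := by simp [A', hi.symm]
  have h₄ : A' i' j' = d := by simp [A', hj', hi.symm]
  have hrow : ∀ k l, k ≠ i → k ≠ i' → A' k l = A k l := fun k l hk hk' => by simp [A', hk, hk']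
  have hcolumn : ∀ k l, l ≠ j → l ≠ j' → A' k l = A k l := fun k l hl hl' => by
    simp [A', hl, hl']
  have hpos : ∀ k l, 0 < A' k l := fun k l => by
    have := hA0 k l
    simp only [A']
    split_ifs <;> assumption
  refine ⟨A', ⟨fun k l => (hpos k l).le, fun k => ?_⟩, hpos, ?_, fun l hl => ?_⟩
  · rw [← hA.2 k]
    refine sum_eq_sum_of_eq_off_pair hj'.symm ?_ (hcolumn k)
    by_cases hk : k = i
    · subst hk
      rw [h₁, h₂, hab]
    by_cases hk' : k = i'
    · subst hk'
      rw [h₃, h₄, hcd]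
    rw [hrow k j hk hk', hrow k j' hk hk']
  · have hoff : ∑ k, (Q k j / A' k j - Q k j / A k j) =
        (Q i j / A' i j - Q i j / A i j) + (Q i' j / A' i' j - Q i' j / A i' j) := by
      refine Fintype.sum_eq_add i i' hi fun k hk => ?_
      rw [hrow k j hk.1 hk.2, sub_self]
    rw [Finset.sum_sub_distrib, h₁, h₃] at hoff
    linarith
  · by_cases hl' : l = j'
    · subst hl'
      refine sum_eq_sum_of_eq_off_pair hi (by rw [h₂, h₄, hcol']) fun k hk hk' => ?_
      rw [hrow k l hk hk']
    · simp only [hcolumn _ l hl hl']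

lemma memDBar_of_pos_of_sum_div_le_one [Nontrivial ι] [Nontrivial κ] {A Q : Matrix ι κ ℝ}
    (hQ : ∀ i j, 0 < Q i j) (hA : RightStochastic A) (hA0 : ∀ i j, 0 < A i j)
    (hcol : ∀ j, ∑ i, Q i j / A i j ≤ 1) : MemDBar Q := by
  have key : ∀ s : Finset κ, ∃ A : Matrix ι κ ℝ, RightStochastic A ∧ (∀ i j, 0 < A i j) ∧
      (∀ j, ∑ i, Q i j / A i j ≤ 1) ∧ ∀ j ∈ s, ∑ i, Q i j / A i j = 1 := by
    intro s
    induction s using Finset.induction_on with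
    | empty => exact ⟨A, hA, hA0, hcol, by simp⟩
    | insert j s _ ih =>
      obtain ⟨B, hB, hB0, hle, heq⟩ := ih
      obtain ⟨C, hC, hC0, hj, hne⟩ := hB.exists_sum_div_column_eq_one hQ hB0 (hle j)
      refine ⟨C, hC, hC0, fun l => ?_, fun l hl => ?_⟩
      · by_cases h : l = j
        · rw [h, hj]
        · exact (hne l h).trans_le (hle l)
      · by_cases h : l = j
        · rw [h, hj]
        · exact (hne l h).trans (heq l (Finset.mem_of_mem_insert_of_ne hl h))
  obtain ⟨B, hB, hB0, -, heq⟩ := key Finset.univ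
  exact ⟨B, fun i j => Q i j / B i j, hB,
    ⟨fun i j => (div_pos (hQ i j) (hB0 i j)).le, fun j => heq j (Finset.mem_univ j)⟩,
    fun i j => (mul_div_cancel₀ _ (hB0 i j).ne').symm⟩

lemma isClosed_setOf_memDBar : IsClosed {P : Matrix ι κ ℝ | MemDBar P} := by
  have himage : {P : Matrix ι κ ℝ | MemDBar P} =
      (fun p : Matrix ι κ ℝ × Matrix κ ι ℝ => Matrix.of fun i j => p.1 i j * p.2 j i) ''
        ({A | RightStochastic A} ×ˢ {B | RightStochastic B}) := by
    ext P
    constructor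
    · rintro ⟨A, B, hA, hB, h⟩
      refine ⟨(A, B.transpose), ⟨hA, fun j i => hB.1 i j, hB.2⟩, ?_⟩
      ext i j
      exact (h i j).symm
    · rintro ⟨⟨A, B⟩, ⟨hA, hB⟩, rfl⟩
      exact ⟨A, B.transpose, hA, ⟨fun i j => hB.1 j i, hB.2⟩, fun _ _ => rfl⟩
  rw [himage]
  refine ((isCompact_setOf_rightStochastic.prod isCompact_setOf_rightStochastic).image
    ?_).isClosed
  exact continuous_matrix fun i j =>
    (continuous_fst.matrix_elem i j).mul (continuous_snd.matrix_elem j i)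

lemma MemDBar.mono [Nontrivial ι] [Nontrivial κ] {P Q : Matrix ι κ ℝ} (hP : MemDBar P)
    (hQ : ∀ i j, 0 ≤ Q i j ∧ Q i j ≤ P i j) : MemDBar Q := by
  obtain ⟨A, B, hA, hB, hAB⟩ := hP
  let R : ℝ → Matrix ι κ ℝ := fun ε => Matrix.of fun i j =>
    (1 - ε) ^ 2 * Q i j + ε / Fintype.card κ * (ε / Fintype.card ι)
  have hR : Filter.Tendsto R (nhdsWithin 0 (Set.Ioi 0)) (nhds Q) := by
    have hcont : Continuous R := continuous_matrix fun i j => by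
      simp only [R, Matrix.of_apply]
      fun_prop
    have h0 : R 0 = Q := by
      ext i j
      simp [R]
    exact h0 ▸ (hcont.tendsto 0).mono_left nhdsWithin_le_nhds
  refine isClosed_setOf_memDBar.mem_of_tendsto hR ?_
  filter_upwards [Ioo_mem_nhdsGT (zero_lt_one' ℝ)] with ε ⟨hε, hε1⟩
  have hδ : 0 < 1 - ε := sub_pos.2 hε1
  have hBt : RightStochastic B.transpose := ⟨fun j i => hB.1 i j, hB.2⟩
  have hcκ : 0 < ε / (Fintype.card κ : ℝ) := by positivity
  have hcι : 0 < ε / (Fintype.card ι : ℝ) := by positivity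
  have hA0 : ∀ i j, 0 < (1 - ε) * A i j + ε / Fintype.card κ := fun i j => by
    have := mul_nonneg hδ.le (hA.1 i j)
    linarith
  refine memDBar_of_pos_of_sum_div_le_one (fun i j => ?_) (hA.mix_uniform hε hε1) hA0
    fun j => ?_
  · have := mul_nonneg (sq_nonneg (1 - ε)) (hQ i j).1
    have := mul_pos hcκ hcι
    simp only [R, Matrix.of_apply]
    linarith
  · refine (Finset.sum_le_sum fun i _ => ?_).trans_eq ((hBt.mix_uniform hε hε1).2 j)
    rw [div_le_iff₀' (hA0 i j)]
    have hle := mul_le_mul_of_nonneg_left (hAB i j ▸ (hQ i j).2) (sq_nonneg (1 - ε))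
    have h₁ := mul_nonneg (mul_nonneg hδ.le (hA.1 i j)) hcι.le
    have h₂ := mul_nonneg (mul_nonneg hδ.le (hB.1 i j)) hcκ.le
    simp only [R, Matrix.of_apply, Matrix.transpose_apply]
    linear_combination hle + h₁ + h₂

end

/-- Lemma 1: for `n, m ≥ 2`, the set `D̄(n,m)` is downward closed under the entrywise
order (within entrywise-nonnegative matrices). -/
theorem memDBar_of_le {n m : ℕ} (hn : 2 ≤ n) (hm : 2 ≤ m)
    (P Q : Matrix (Fin n) (Fin m) ℝ) (hP : MemDBar P)
    (hQ : ∀ i j, 0 ≤ Q i j ∧ Q i j ≤ P i j) :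
    MemDBar Q := by
  have := Fin.nontrivial_iff_two_le.2 hn
  have := Fin.nontrivial_iff_two_le.2 hm
  exact hP.mono hQ

end
end

section
/- Let (S^A, S^B) be a pair of orthonormal families in a finite-dimensional complex inner product space H with |S^A| = |S^B| = 2, and let P be the 2×2 real matrix with entries P_{ab} = |⟨φ^A_a, φ^B_b⟩|² (indices a,b ∈ {1,2}). Then (S^A, S^B) is perfectly distinguishable by post-processing if and only if (1−P_{11})(1−P_{22}) + (1−P_{12})(1−P_{21}) − 2·(P_{11}P_{12}P_{21}P_{22})^{1/2} ≥ 1. -/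
open scoped Classical

noncomputable section

/-! ### From a measurement to a pair of stochastic matrices -/

/-- Cauchy–Schwarz inequality for the form of a positive semidefinite operator. -/
lemma norm_inner_map_sq_le {H : Type*} [NormedAddCommGroup H] [InnerProductSpace ℂ H]
    (T : H →ₗ[ℂ] H) (hT : ∀ x, 0 ≤ (⟪x, T x⟫_ℂ).re ∧ (⟪x, T x⟫_ℂ).im = 0) (x y : H) :
    ‖⟪x, T y⟫_ℂ‖ ^ 2 ≤ (⟪x, T x⟫_ℂ).re * (⟪y, T y⟫_ℂ).re := by
  have hsymm : T.IsSymmetric := by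
    rw [LinearMap.isSymmetric_iff_inner_map_self_real]
    intro v
    rw [inner_conj_symm, ← inner_conj_symm (T v) v]
    exact (Complex.conj_eq_iff_im.mpr (hT v).2).symm
  let c : PreInnerProductSpace.Core ℂ H :=
    { inner := fun x y => ⟪x, T y⟫_ℂ
      conj_inner_symm := fun x y => by
        rw [inner_conj_symm]; exact hsymm x y
      re_inner_nonneg := fun x => (hT x).1
      add_left := fun x y z => inner_add_left _ _ _
      smul_left := fun x y r => inner_smul_left _ _ _ }
  have key : ‖⟪x, T y⟫_ℂ‖ * ‖⟪y, T x⟫_ℂ‖ ≤ (⟪x, T x⟫_ℂ).re * (⟪y, T y⟫_ℂ).re :=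
    @InnerProductSpace.Core.inner_mul_inner_self_le ℂ H _ _ _ c x y
  rwa [← hsymm y x, norm_inner_symm (T y) x, ← sq] at key

lemma sum_re_inner_filter_eq_one {H : Type*} [NormedAddCommGroup H] [InnerProductSpace ℂ H]
    {Ω K : Type*} [Fintype Ω] {M : Ω → H →ₗ[ℂ] H} {f : Ω → K} {φ : K → H} {a : K}
    (h : ∑ ω ∈ Finset.univ.filter (fun ω => f ω = a), ⟪φ a, M ω (φ a)⟫_ℂ = 1) :
    ∑ ω ∈ Finset.univ.filter (fun ω => f ω = a), (⟪φ a, M ω (φ a)⟫_ℂ).re = 1 := by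
  simpa using congrArg Complex.re h

/-- An outcome that is not attributed to a unit vector has probability zero in it. -/
lemma re_inner_eq_zero_of_label_ne {H : Type*} [NormedAddCommGroup H] [InnerProductSpace ℂ H]
    {Ω K : Type*} [Fintype Ω] {M : Ω → H →ₗ[ℂ] H} (hM : IsPOVM M) {f : Ω → K} {φ : K → H}
    {a : K} (ha : ‖φ a‖ = 1)
    (h : ∑ ω ∈ Finset.univ.filter (fun ω => f ω = a), ⟪φ a, M ω (φ a)⟫_ℂ = 1)
    {ω : Ω} (hω : f ω ≠ a) : (⟪φ a, M ω (φ a)⟫_ℂ).re = 0 := by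
  have htot : ∑ ω, (⟪φ a, M ω (φ a)⟫_ℂ).re = 1 := by
    rw [← Complex.re_sum, ← inner_sum, ← LinearMap.sum_apply, hM.2, LinearMap.id_apply,
      inner_self_eq_norm_sq_to_K, ha]
    simp
  rw [← Finset.sum_filter_add_sum_filter_not Finset.univ (fun ω => f ω = a),
    sum_re_inner_filter_eq_one h, add_eq_left] at htot
  exact (Finset.sum_eq_zero_iff_of_nonneg fun i _ => (hM.1 i _).1).mp htot ω (by simp [hω])

/-- The squared overlaps of a perfectly distinguishable pair are dominated by the entrywise
product of a right stochastic and a left stochastic matrix. -/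
lemma PerfectlyDistinguishable.exists_stochastic_mul_ge {H : Type*} [NormedAddCommGroup H]
    [InnerProductSpace ℂ H] {KA KB : Type*} [Fintype KA] [Fintype KB] {φA : KA → H} {φB : KB → H}
    (hA : ∀ a, ‖φA a‖ = 1) (hB : ∀ b, ‖φB b‖ = 1) (h : PerfectlyDistinguishable φA φB) :
    ∃ A B : Matrix KA KB ℝ, RightStochastic A ∧ LeftStochastic B ∧
      ∀ a b, ‖⟪φA a, φB b⟫_ℂ‖ ^ 2 ≤ A a b * B a b := by
  obtain ⟨N, M, fA, fB, hM, h1, h2⟩ := h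
  refine ⟨fun a b => ∑ ω ∈ Finset.univ.filter (fun ω => fA ω = a) with fB ω = b,
      (⟪φA a, M ω (φA a)⟫_ℂ).re,
    fun a b => ∑ ω ∈ Finset.univ.filter (fun ω => fB ω = b) with fA ω = a,
      (⟪φB b, M ω (φB b)⟫_ℂ).re,
    ⟨fun a b => Finset.sum_nonneg fun i _ => (hM.1 i _).1, fun a => ?_⟩,
    ⟨fun a b => Finset.sum_nonneg fun i _ => (hM.1 i _).1, fun b => ?_⟩, fun a b => ?_⟩
  · exact (Finset.sum_fiberwise _ _ _).trans (sum_re_inner_filter_eq_one (h1 a))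
  · exact (Finset.sum_fiberwise _ _ _).trans (sum_re_inner_filter_eq_one (h2 b))
  · beta_reduce
    rw [show ((Finset.univ.filter (fun ω => fB ω = b)).filter fun ω => fA ω = a) =
        (Finset.univ.filter (fun ω => fA ω = a)).filter fun ω => fB ω = b by
          rw [Finset.filter_comm]]
    set F := (Finset.univ.filter (fun ω => fA ω = a)).filter fun ω => fB ω = b with hF
    have hsum : ⟪φA a, φB b⟫_ℂ = ∑ ω ∈ F, ⟪φA a, M ω (φB b)⟫_ℂ := by
      rw [Finset.sum_subset (Finset.subset_univ F), ← inner_sum, ← LinearMap.sum_apply, hM.2,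
        LinearMap.id_apply]
      intro ω _ hω
      have hcs := norm_inner_map_sq_le (M ω) (hM.1 ω) (φA a) (φB b)
      have h0 : (⟪φA a, M ω (φA a)⟫_ℂ).re * (⟪φB b, M ω (φB b)⟫_ℂ).re = 0 := by
        by_cases hfa : fA ω = a
        · have hfb : fB ω ≠ b := fun hfb => hω (by simp [hF, hfa, hfb])
          rw [re_inner_eq_zero_of_label_ne hM (hB b) (h2 b) hfb, mul_zero]
        · rw [re_inner_eq_zero_of_label_ne hM (hA a) (h1 a) hfa, zero_mul]
      rw [h0] at hcs
      exact norm_eq_zero.mp (pow_eq_zero_iff two_ne_zero |>.mp (le_antisymm hcs (sq_nonneg _)))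
    rw [hsum]
    calc ‖∑ ω ∈ F, ⟪φA a, M ω (φB b)⟫_ℂ‖ ^ 2
        ≤ (∑ ω ∈ F, √(⟪φA a, M ω (φA a)⟫_ℂ).re * √(⟪φB b, M ω (φB b)⟫_ℂ).re) ^ 2 := by
          gcongr
          refine norm_sum_le_of_le _ fun ω _ => ?_
          rw [← Real.sqrt_mul (hM.1 ω _).1]
          exact Real.le_sqrt_of_sq_le (norm_inner_map_sq_le (M ω) (hM.1 ω) _ _)
      _ ≤ (∑ ω ∈ F, √(⟪φA a, M ω (φA a)⟫_ℂ).re ^ 2) *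
          ∑ ω ∈ F, √(⟪φB b, M ω (φB b)⟫_ℂ).re ^ 2 := Finset.sum_mul_sq_le_sq_mul_sq _ _ _
      _ = _ := by simp only [Real.sq_sqrt (hM.1 _ _).1]

/-! ### From a pair of stochastic matrices to a measurement -/

/-- If every outcome with the wrong label has probability zero in a unit vector, the outcomes with
the right label have total probability one. -/
lemma IsPOVM.sum_inner_filter_eq_one {H : Type*} [NormedAddCommGroup H] [InnerProductSpace ℂ H]
    {Ω K : Type*} [Fintype Ω] {M : Ω → H →ₗ[ℂ] H} (hM : IsPOVM M) {f : Ω → K} {a : K} {x : H}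
    (hx : ‖x‖ = 1) (h : ∀ ω, f ω ≠ a → ⟪x, M ω x⟫_ℂ = 0) :
    ∑ ω ∈ Finset.univ.filter (fun ω => f ω = a), ⟪x, M ω x⟫_ℂ = 1 := by
  rw [Finset.sum_filter_of_ne fun ω _ hω => not_imp_comm.mp (h ω) hω, ← inner_sum,
    ← LinearMap.sum_apply, hM.2, LinearMap.id_apply, inner_self_eq_norm_sq_to_K, hx]
  simp

/-- Perfect distinguishability from a POVM indexed by an arbitrary finite type. -/
lemma IsPOVM.perfectlyDistinguishable {H : Type*} [NormedAddCommGroup H] [InnerProductSpace ℂ H]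
    {KA KB Ω : Type*} [Fintype KA] [Fintype KB] [Fintype Ω] {φA : KA → H} {φB : KB → H}
    (hA : ∀ a, ‖φA a‖ = 1) (hB : ∀ b, ‖φB b‖ = 1) {M : Ω → H →ₗ[ℂ] H} (hM : IsPOVM M)
    {fA : Ω → KA} {fB : Ω → KB} (hMA : ∀ a ω, fA ω ≠ a → ⟪φA a, M ω (φA a)⟫_ℂ = 0)
    (hMB : ∀ b ω, fB ω ≠ b → ⟪φB b, M ω (φB b)⟫_ℂ = 0) :
    PerfectlyDistinguishable φA φB := by
  let e := Fintype.equivFin Ω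
  have hM' : IsPOVM fun i => M (e.symm i) :=
    ⟨fun i => hM.1 _, (Equiv.sum_comp e.symm M).trans hM.2⟩
  exact ⟨_, _, fun i => fA (e.symm i), fun i => fB (e.symm i), hM',
    fun a => hM'.sum_inner_filter_eq_one (hA a) fun i => hMA a _,
    fun b => hM'.sum_inner_filter_eq_one (hB b) fun i => hMB b _⟩

/-- A family of functionals with `∑ ‖V ω x‖² ≤ ‖x‖²`, tight on both ensembles and vanishing on
the states with a different label, yields perfect distinguishability. -/
lemma perfectlyDistinguishable_of_functionals {H : Type*} [NormedAddCommGroup H]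
    [InnerProductSpace ℂ H] [FiniteDimensional ℂ H] {KA KB Ω : Type*} [Fintype KA] [Fintype KB]
    [Nonempty KA] [Nonempty KB] [Fintype Ω] {φA : KA → H} {φB : KB → H}
    (hA : ∀ a, ‖φA a‖ = 1) (hB : ∀ b, ‖φB b‖ = 1)
    (V : Ω → H →ₗ[ℂ] ℂ) (fA : Ω → KA) (fB : Ω → KB)
    (hV : ∀ x, ∑ ω, ‖V ω x‖ ^ 2 ≤ ‖x‖ ^ 2)
    (hVA : ∀ a, ∑ ω, ‖V ω (φA a)‖ ^ 2 = 1) (hVB : ∀ b, ∑ ω, ‖V ω (φB b)‖ ^ 2 = 1)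
    (hzA : ∀ a ω, fA ω ≠ a → V ω (φA a) = 0) (hzB : ∀ b ω, fB ω ≠ b → V ω (φB b) = 0) :
    PerfectlyDistinguishable φA φB := by
  let E : Ω → H →ₗ[ℂ] H := fun ω => (V ω).adjoint ∘ₗ V ω
  have hE : ∀ ω x, ⟪x, E ω x⟫_ℂ = ((‖V ω x‖ ^ 2 : ℝ) : ℂ) := fun ω x => by
    simp only [E, LinearMap.comp_apply, LinearMap.adjoint_inner_right,
      inner_self_eq_norm_sq_to_K]
    simp
  let M : Option Ω → H →ₗ[ℂ] H := fun o => o.elim (LinearMap.id - ∑ ω, E ω) E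
  have hnone : ∀ x, ⟪x, M none x⟫_ℂ = ((‖x‖ ^ 2 - ∑ ω, ‖V ω x‖ ^ 2 : ℝ) : ℂ) := fun x => by
    simp only [M, Option.elim, LinearMap.sub_apply, LinearMap.sum_apply, inner_sub_right,
      inner_sum, hE, LinearMap.id_apply, inner_self_eq_norm_sq_to_K]
    simp
  have hsome : ∀ ω x, ⟪x, M (some ω) x⟫_ℂ = ((‖V ω x‖ ^ 2 : ℝ) : ℂ) := hE
  have hM : IsPOVM M := by
    refine ⟨fun o x => ?_, ?_⟩
    · cases o with
      | none =>
        rw [hnone, Complex.ofReal_re, Complex.ofReal_im]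
        exact ⟨sub_nonneg.mpr (hV x), rfl⟩
      | some ω =>
        rw [hsome, Complex.ofReal_re, Complex.ofReal_im]
        exact ⟨sq_nonneg _, rfl⟩
    · simp [Fintype.sum_option, M]
  refine hM.perfectlyDistinguishable hA hB
    (fA := fun o => o.elim (Classical.arbitrary KA) fA)
    (fB := fun o => o.elim (Classical.arbitrary KB) fB) (fun a o ho => ?_) fun b o ho => ?_
  · cases o with
    | none => rw [hnone, hVA, hA]; simp
    | some ω => rw [hsome, hzA a ω ho]; simp
  · cases o with
    | none => rw [hnone, hVB, hB]; simp
    | some ω => rw [hsome, hzB b ω ho]; simp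

/-- Functionals on the source of `T` whose squared moduli add up to `‖T x‖²` factor through `T`
to functionals on the target which form a contraction. -/
lemma exists_functionals_comp_eq {E H : Type*} [AddCommGroup E] [Module ℂ E]
    [NormedAddCommGroup H] [InnerProductSpace ℂ H] [FiniteDimensional ℂ H] {Ω : Type*} [Fintype Ω]
    (T : E →ₗ[ℂ] H) (W : Ω → E →ₗ[ℂ] ℂ) (h : ∀ x, ∑ ω, ‖W ω x‖ ^ 2 = ‖T x‖ ^ 2) :
    ∃ V : Ω → H →ₗ[ℂ] ℂ, (∀ x, ∑ ω, ‖V ω x‖ ^ 2 ≤ ‖x‖ ^ 2) ∧ ∀ ω x, V ω (T x) = W ω x := by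
  obtain ⟨R, hR⟩ := T.rangeRestrict.exists_rightInverse_of_surjective T.range_rangeRestrict
  have hTR : ∀ y : LinearMap.range T, T (R y) = y := fun y =>
    congrArg Subtype.val (LinearMap.congr_fun hR y)
  let p := (LinearMap.range T).orthogonalProjectionOnto
  refine ⟨fun ω => W ω ∘ₗ R ∘ₗ p.toLinearMap, fun x => ?_, fun ω x => ?_⟩
  · have hp : ‖p x‖ ≤ ‖x‖ := (LinearMap.range T).norm_orthogonalProjectionOnto_apply_le x
    calc ∑ ω, ‖W ω (R (p x))‖ ^ 2 = ‖p x‖ ^ 2 := by rw [h, hTR]; rfl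
      _ ≤ ‖x‖ ^ 2 := by gcongr
  · have hpx : p (T x) = ⟨T x, LinearMap.mem_range_self T x⟩ :=
      (LinearMap.range T).orthogonalProjectionOnto_mem_subspace_eq_self
        ⟨T x, LinearMap.mem_range_self T x⟩
    have hz : T (R (p (T x)) - x) = 0 := by rw [map_sub, hTR, hpx, sub_self]
    have hsum : ∑ ω, ‖W ω (R (p (T x)) - x)‖ ^ 2 = 0 := by rw [h, hz]; simp
    have hω := (Finset.sum_eq_zero_iff_of_nonneg fun _ _ => sq_nonneg _).mp hsum ω
      (Finset.mem_univ ω)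
    rw [pow_eq_zero_iff two_ne_zero, norm_eq_zero, map_sub, sub_eq_zero] at hω
    exact hω

/-- Completing the square in a positive semidefinite Hermitian form on `ℂ²`. -/
lemma sq_norm_add_sq_norm_eq_form {r s : ℝ} (hr : 0 ≤ r) (hs : 0 ≤ s) {c : ℂ} (h : ‖c‖ ^ 2 ≤ r * s)
    (x y : ℂ) :
    ‖(√r : ℂ) * x + (c / √r) * y‖ ^ 2 + ‖(√(s - ‖c‖ ^ 2 / r) : ℂ) * y‖ ^ 2 =
      r * ‖x‖ ^ 2 + s * ‖y‖ ^ 2 + 2 * (starRingEnd ℂ x * y * c).re := by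
  rcases hr.eq_or_lt with rfl | hr
  · have hc : c = 0 := by
      rw [zero_mul] at h
      exact norm_eq_zero.mp (pow_eq_zero_iff two_ne_zero |>.mp (le_antisymm h (sq_nonneg _)))
    simp [hc, mul_pow, abs_of_nonneg, Real.sq_sqrt hs]
  · have hq : 0 ≤ s - ‖c‖ ^ 2 / r := by
      rw [sub_nonneg, div_le_iff₀ hr]; linarith
    have hsr : (√r : ℂ) ≠ 0 := by
      exact_mod_cast (Real.sqrt_pos.mpr hr).ne'
    have hcross : ((√r : ℂ) * x * starRingEnd ℂ ((c / √r) * y)).re =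
        (starRingEnd ℂ x * y * c).re := by
      rw [← Complex.conj_re]
      congr 1
      simp only [map_mul, map_div₀, Complex.conj_conj, Complex.conj_ofReal]
      field_simp
    rw [Complex.sq_norm (_ + _), Complex.normSq_add, hcross]
    simp only [← Complex.sq_norm, norm_mul, norm_div, Complex.norm_real, mul_pow, div_pow,
      Real.norm_eq_abs, sq_abs, Real.sq_sqrt hr.le, Real.sq_sqrt hq]
    ring

lemma Orthonormal.sq_norm_sum_smul {H K : Type*} [NormedAddCommGroup H]
    [InnerProductSpace ℂ H] [Fintype K] {φ : K → H} (hφ : Orthonormal ℂ φ) (x : K → ℂ) :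
    ‖∑ k, x k • φ k‖ ^ 2 = ∑ k, ‖x k‖ ^ 2 := by
  have h := hφ.inner_sum x x Finset.univ
  simp only [inner_self_eq_norm_sq_to_K, RCLike.conj_mul] at h
  exact_mod_cast h

lemma sq_norm_sum_smul_add_sum_smul {H : Type*} [NormedAddCommGroup H] [InnerProductSpace ℂ H]
    {KA KB : Type*} [Fintype KA] [Fintype KB] {φA : KA → H} {φB : KB → H}
    (hA : Orthonormal ℂ φA) (hB : Orthonormal ℂ φB) (x : KA → ℂ) (y : KB → ℂ) :
    ‖∑ a, x a • φA a + ∑ b, y b • φB b‖ ^ 2 = ∑ a, ‖x a‖ ^ 2 + ∑ b, ‖y b‖ ^ 2 +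
      2 * ∑ a, ∑ b, (starRingEnd ℂ (x a) * y b * ⟪φA a, φB b⟫_ℂ).re := by
  rw [norm_add_sq (𝕜 := ℂ), hA.sq_norm_sum_smul, hB.sq_norm_sum_smul, sum_inner]
  simp_rw [inner_sum, inner_smul_left, inner_smul_right, map_sum, mul_assoc,
    RCLike.re_to_complex]
  ring

/-- Orthonormal families whose squared overlaps are dominated by the entrywise product of a right
stochastic and a left stochastic matrix are perfectly distinguishable. -/
lemma perfectlyDistinguishable_of_stochastic_mul_ge {H : Type*} [NormedAddCommGroup H]
    [InnerProductSpace ℂ H] [FiniteDimensional ℂ H] {KA KB : Type*} [Fintype KA] [Fintype KB]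
    [Nonempty KA] [Nonempty KB] {φA : KA → H} {φB : KB → H}
    (hA : Orthonormal ℂ φA) (hB : Orthonormal ℂ φB) {A B : Matrix KA KB ℝ}
    (hRA : RightStochastic A) (hLB : LeftStochastic B)
    (h : ∀ a b, ‖⟪φA a, φB b⟫_ℂ‖ ^ 2 ≤ A a b * B a b) :
    PerfectlyDistinguishable φA φB := by
  let T : (KA → ℂ) × (KB → ℂ) →ₗ[ℂ] H :=
    (Fintype.linearCombination ℂ φA).coprod (Fintype.linearCombination ℂ φB)
  let W : (KA × KB) × Bool → (KA → ℂ) × (KB → ℂ) →ₗ[ℂ] ℂ := fun ω =>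
    bif ω.2 then
      (√(B ω.1.1 ω.1.2 - ‖⟪φA ω.1.1, φB ω.1.2⟫_ℂ‖ ^ 2 / A ω.1.1 ω.1.2) : ℂ) •
        LinearMap.proj ω.1.2 ∘ₗ LinearMap.snd ℂ _ _
    else
      (√(A ω.1.1 ω.1.2) : ℂ) • LinearMap.proj ω.1.1 ∘ₗ LinearMap.fst ℂ _ _ +
        (⟪φA ω.1.1, φB ω.1.2⟫_ℂ / √(A ω.1.1 ω.1.2)) •
          LinearMap.proj ω.1.2 ∘ₗ LinearMap.snd ℂ _ _
  have hW : ∀ z, ∑ ω, ‖W ω z‖ ^ 2 = ‖T z‖ ^ 2 := by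
    rintro ⟨x, y⟩
    have hT : T (x, y) = ∑ a, x a • φA a + ∑ b, y b • φB b := rfl
    rw [hT, sq_norm_sum_smul_add_sum_smul hA hB, Fintype.sum_prod_type]
    have hω : ∀ ω : KA × KB, ∑ i, ‖W (ω, i) (x, y)‖ ^ 2 =
        A ω.1 ω.2 * ‖x ω.1‖ ^ 2 + B ω.1 ω.2 * ‖y ω.2‖ ^ 2 +
          2 * (starRingEnd ℂ (x ω.1) * y ω.2 * ⟪φA ω.1, φB ω.2⟫_ℂ).re := fun ω => by
      rw [← sq_norm_add_sq_norm_eq_form (hRA.1 _ _) (hLB.1 _ _) (h _ _), Fintype.sum_bool,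
        add_comm]
      rfl
    simp only [hω]
    rw [Fintype.sum_prod_type]
    simp only [Finset.sum_add_distrib, Finset.mul_sum]
    congr 2
    · simp only [← Finset.sum_mul, hRA.2, one_mul]
    · rw [Finset.sum_comm]
      simp only [← Finset.sum_mul, hLB.2, one_mul]
  obtain ⟨V, hV, hVT⟩ := exists_functionals_comp_eq T W hW
  have hTA : ∀ a, T (Pi.single a 1, 0) = φA a := fun a => by
    simp [T, Fintype.linearCombination_apply_single]
  have hTB : ∀ b, T (0, Pi.single b 1) = φB b := fun b => by
    simp [T, Fintype.linearCombination_apply_single]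
  refine perfectlyDistinguishable_of_functionals hA.1 hB.1 V (fun ω => ω.1.1) (fun ω => ω.1.2) hV
    (fun a => ?_) (fun b => ?_) ?_ ?_
  · rw [← hTA]
    simp only [hVT]
    rw [hW, hTA, hA.1, one_pow]
  · rw [← hTB]
    simp only [hVT]
    rw [hW, hTB, hB.1, one_pow]
  · rintro a ⟨ω, i⟩ hω
    rw [← hTA, hVT]
    cases i <;> simp [W, Pi.single_eq_of_ne hω]
  · rintro b ⟨ω, i⟩ hω
    rw [← hTB, hVT]
    cases i <;> simp [W, Pi.single_eq_of_ne hω]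

/-! ### The criterion for two-by-two matrices -/

lemma rightStochastic_two {x y : ℝ} (hx₀ : 0 ≤ x) (hx₁ : x ≤ 1) (hy₀ : 0 ≤ y) (hy₁ : y ≤ 1) :
    RightStochastic !![x, 1 - x; y, 1 - y] := by
  constructor
  · intro i j
    fin_cases i <;> fin_cases j <;> simp <;> assumption
  · intro i
    fin_cases i <;> simp

lemma leftStochastic_two {x y : ℝ} (hx₀ : 0 ≤ x) (hx₁ : x ≤ 1) (hy₀ : 0 ≤ y) (hy₁ : y ≤ 1) :
    LeftStochastic !![x, y; 1 - x, 1 - y] := by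
  constructor
  · intro i j
    fin_cases i <;> fin_cases j <;> simp <;> assumption
  · intro j
    fin_cases j <;> simp

/-- Cauchy–Schwarz for two nonnegative pairs, with square roots. -/
lemma sq_sqrt_add_sqrt_le {p q d e a b : ℝ}
    (hd : 0 ≤ d) (he : 0 ≤ e) (ha : 0 ≤ a) (hb : 0 ≤ b)
    (hpa : p ≤ d * a) (hqb : q ≤ e * b) : (√p + √q) ^ 2 ≤ (d + e) * (a + b) := by
  have h1 : √p ≤ √d * √a := by
    rw [← Real.sqrt_mul hd]; exact Real.sqrt_le_sqrt hpa
  have h2 : √q ≤ √e * √b := by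
    rw [← Real.sqrt_mul he]; exact Real.sqrt_le_sqrt hqb
  calc (√p + √q) ^ 2 ≤ (√d * √a + √e * √b) ^ 2 := by gcongr
    _ ≤ (√d ^ 2 + √e ^ 2) * (√a ^ 2 + √b ^ 2) := by
      nlinarith [sq_nonneg (√d * √b - √e * √a)]
    _ = _ := by simp only [Real.sq_sqrt, hd, he, ha, hb]

lemma criterion_iff_sq_sqrt_add_sqrt_le {p q r s : ℝ} (hp : 0 ≤ p) (hq : 0 ≤ q) (hr : 0 ≤ r)
    (hs : 0 ≤ s) :
    (1 - p) * (1 - s) + (1 - q) * (1 - r) - 2 * √(p * q * r * s) ≥ 1 ↔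
      (√(p * r) + √(q * s)) ^ 2 ≤ (1 - p - q) * (1 - r - s) := by
  rw [add_sq, Real.sq_sqrt (mul_nonneg hp hr), Real.sq_sqrt (mul_nonneg hq hs), mul_assoc 2,
    ← Real.sqrt_mul (mul_nonneg hp hr), show p * r * (q * s) = p * q * r * s by ring]
  constructor <;> intro h <;> linarith

lemma sq_sqrt_add_sqrt_le_of_stochastic_mul {P A B : Matrix (Fin 2) (Fin 2) ℝ}
    (hP : ∀ i j, 0 ≤ P i j) (hA : RightStochastic A) (hB : LeftStochastic B)
    (h : ∀ i j, P i j ≤ A i j * B i j) :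
    (√(P 0 0 * P 1 0) + √(P 0 1 * P 1 1)) ^ 2 ≤
      (1 - P 0 0 - P 0 1) * (1 - P 1 0 - P 1 1) := by
  have hA0 := hA.2 0
  have hA1 := hA.2 1
  have hB0 := hB.2 0
  have hB1 := hB.2 1
  rw [Fin.sum_univ_two] at hA0 hA1 hB0 hB1
  have hm : ∀ i j k l, 0 ≤ A i j * B k l := fun i j k l => mul_nonneg (hA.1 i j) (hB.1 k l)
  have hd : A 0 0 * B 1 0 + A 0 1 * B 1 1 ≤ 1 - P 0 0 - P 0 1 := by
    have h0 := h 0 0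
    have h1 := h 0 1
    rw [← eq_sub_iff_add_eq'] at hB0 hB1
    rw [hB0, hB1]
    linarith
  have he : A 1 0 * B 0 0 + A 1 1 * B 0 1 ≤ 1 - P 1 0 - P 1 1 := by
    have h0 := h 1 0
    have h1 := h 1 1
    rw [← eq_sub_iff_add_eq] at hB0 hB1
    rw [hB0, hB1]
    linarith
  have hcol : ∀ j, P 0 j * P 1 j ≤ A 0 j * B 1 j * (A 1 j * B 0 j) := fun j =>
    (mul_le_mul (h 0 j) (h 1 j) (hP 1 j) (hm 0 j 0 j)).trans_eq (by ring)
  calc _ ≤ (A 0 0 * B 1 0 + A 0 1 * B 1 1) * (A 1 0 * B 0 0 + A 1 1 * B 0 1) :=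
        sq_sqrt_add_sqrt_le
          (hm _ _ _ _) (hm _ _ _ _) (hm _ _ _ _) (hm _ _ _ _) (hcol 0) (hcol 1)
    _ ≤ _ := mul_le_mul hd he (add_nonneg (hm _ _ _ _) (hm _ _ _ _))
        ((add_nonneg (hm _ _ _ _) (hm _ _ _ _)).trans hd)

lemma exists_le_mul_le_mul_one_sub {p q s t : ℝ} (hp : 0 ≤ p) (hs : 0 ≤ s)
    (ht : 0 ≤ t) (h : p * q ≤ s * t) :
    ∃ u, 0 ≤ u ∧ u ≤ 1 ∧ p ≤ (p + s) * u ∧ q ≤ (q + t) * (1 - u) := by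
  rcases (add_nonneg hp hs).eq_or_lt with h0 | h0
  · exact ⟨0, le_rfl, zero_le_one, by linarith, by linarith⟩
  · refine ⟨p / (p + s), by positivity, (div_le_one h0).mpr (by linarith), ?_, ?_⟩
    · rw [mul_div_cancel₀ _ h0.ne']
    · rw [one_sub_div h0.ne', add_sub_cancel_left, ← mul_div_assoc, le_div_iff₀ h0]
      linarith

lemma exists_weight {a b m : ℝ} (ha : 0 ≤ a) (hb : 0 ≤ b) (h : (a + b) ^ 2 ≤ m) :
    ∃ l, 0 ≤ l ∧ l ≤ 1 ∧ a ^ 2 ≤ l ^ 2 * m ∧ b ^ 2 ≤ (1 - l) ^ 2 * m := by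
  rcases (add_nonneg ha hb).eq_or_lt with h0 | h0
  · have ha0 : a = 0 := by linarith
    have hb0 : b = 0 := by linarith
    have hm : 0 ≤ m := (sq_nonneg _).trans h
    exact ⟨0, le_rfl, zero_le_one, by simp [ha0], by simp [hb0, hm]⟩
  · have hl : 1 - a / (a + b) = b / (a + b) := by
      rw [one_sub_div h0.ne', add_sub_cancel_left]
    have key : ∀ c : ℝ, c ^ 2 ≤ (c / (a + b)) ^ 2 * m := fun c => by
      rw [div_pow, div_mul_eq_mul_div, le_div_iff₀ (by positivity)]
      gcongr
    exact ⟨a / (a + b), by positivity, (div_le_one h0).mpr (by linarith), key a, hl ▸ key b⟩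

lemma exists_stochastic_mul_of_sq_sqrt_add_sqrt_le {P : Matrix (Fin 2) (Fin 2) ℝ}
    (hP : ∀ i j, 0 ≤ P i j) (hrow : ∀ i, P i 0 + P i 1 ≤ 1)
    (h : (√(P 0 0 * P 1 0) + √(P 0 1 * P 1 1)) ^ 2 ≤
      (1 - P 0 0 - P 0 1) * (1 - P 1 0 - P 1 1)) :
    ∃ A B : Matrix (Fin 2) (Fin 2) ℝ, RightStochastic A ∧ LeftStochastic B ∧
      ∀ i j, P i j ≤ A i j * B i j := by
  obtain ⟨l, hl0, hl1, h0, h1⟩ := exists_weight (Real.sqrt_nonneg _) (Real.sqrt_nonneg _) h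
  rw [Real.sq_sqrt (mul_nonneg (hP _ _) (hP _ _))] at h0 h1
  have hl1' : 0 ≤ 1 - l := sub_nonneg.mpr hl1
  have hd : 0 ≤ 1 - P 0 0 - P 0 1 := by linarith [hrow 0]
  have he : 0 ≤ 1 - P 1 0 - P 1 1 := by linarith [hrow 1]
  obtain ⟨u, hu0, hu1, hu, hu'⟩ := exists_le_mul_le_mul_one_sub (hP 0 0)
    (mul_nonneg hl0 hd) (mul_nonneg hl0 he) (h0.trans_eq (by ring))
  obtain ⟨v, hv0, hv1, hv, hv'⟩ := exists_le_mul_le_mul_one_sub (hP 0 1)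
    (mul_nonneg hl1' hd) (mul_nonneg hl1' he) (h1.trans_eq (by ring))
  have hle : ∀ i, 0 ≤ 1 - P i 0 - P i 1 →
      P i 0 + l * (1 - P i 0 - P i 1) ≤ 1 := fun i hi => by
    linarith [hP i 1, mul_le_of_le_one_left hi hl1]
  refine ⟨_, _, rightStochastic_two (add_nonneg (hP 0 0) (mul_nonneg hl0 hd)) (hle 0 hd)
    (add_nonneg (hP 1 0) (mul_nonneg hl0 he)) (hle 1 he),
    leftStochastic_two hu0 hu1 hv0 hv1, fun i j => ?_⟩
  fin_cases i <;> fin_cases j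
  · exact hu
  · change P 0 1 ≤ (1 - (P 0 0 + l * (1 - P 0 0 - P 0 1))) * v
    exact hv.trans_eq (by ring)
  · exact hu'
  · change P 1 1 ≤ (1 - (P 1 0 + l * (1 - P 1 0 - P 1 1))) * (1 - v)
    exact hv'.trans_eq (by ring)

/-- Corollary: for `|S^A| = |S^B| = 2`, perfect distinguishability by post-processing
holds iff the squared-overlap matrix `P` satisfies
`(1-P₁₁)(1-P₂₂) + (1-P₁₂)(1-P₂₁) - 2√(P₁₁P₁₂P₂₁P₂₂) ≥ 1`. -/
theorem two_by_two_distinguishability_criterion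
    {H : Type*} [NormedAddCommGroup H] [InnerProductSpace ℂ H] [FiniteDimensional ℂ H]
    (φA : Fin 2 → H) (φB : Fin 2 → H) (hA : Orthonormal ℂ φA) (hB : Orthonormal ℂ φB)
    (P : Matrix (Fin 2) (Fin 2) ℝ) (hP : ∀ a b, P a b = ‖⟪φA a, φB b⟫_ℂ‖ ^ 2) :
    PerfectlyDistinguishable φA φB ↔
      (1 - P 0 0) * (1 - P 1 1) + (1 - P 0 1) * (1 - P 1 0)
          - 2 * Real.sqrt (P 0 0 * P 0 1 * P 1 0 * P 1 1) ≥ 1 := by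
  have hP0 : ∀ a b, 0 ≤ P a b := fun a b => hP a b ▸ sq_nonneg _
  have hrow : ∀ a, P a 0 + P a 1 ≤ 1 := fun a => by
    have hbessel := hB.sum_inner_products_le (φA a) (s := Finset.univ)
    rw [Fin.sum_univ_two, hA.1, one_pow] at hbessel
    rwa [hP, hP, norm_inner_symm, norm_inner_symm (φA a)]
  rw [criterion_iff_sq_sqrt_add_sqrt_le (hP0 _ _) (hP0 _ _) (hP0 _ _) (hP0 _ _)]
  constructor
  · intro h
    obtain ⟨A, B, hRA, hLB, hAB⟩ := h.exists_stochastic_mul_ge hA.1 hB.1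
    exact sq_sqrt_add_sqrt_le_of_stochastic_mul hP0 hRA hLB fun a b => hP a b ▸ hAB a b
  · intro h
    obtain ⟨A, B, hRA, hLB, hAB⟩ := exists_stochastic_mul_of_sq_sqrt_add_sqrt_le hP0 hrow h
    exact perfectlyDistinguishable_of_stochastic_mul_ge hA hB hRA hLB fun a b => hP a b ▸ hAB a b

end
end
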